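/- arXiv:0711.3510 — 2 statements merged into one kernel-verified Lean document; each statement's English description precedes it below -/
import Mathlib

section
/- For any n×n real symmetric matrices A₁,…,A_m (n, m ≥ 2), (∑_{r=1}^m ‖A_r‖²)² ≥ 2 ∑_{1≤r<s≤m} ‖[A_r, A_s]‖², where ‖·‖ is the Frobenius norm and [A,B] = AB − BA. -/
open Matrix

attribute [local instance] LieRing.ofAssociativeRing

section SpectralGaps

variable {ι : Type*} [Fintype ι]

/-- The pairs whose squared gap exceeds the sum of all squares form a star. -/
lemma exists_center_of_large_gaps [Nonempty ι] (l : ι → ℝ) :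
    ∃ p, ∀ i j, ∑ k, l k ^ 2 < (l i - l j) ^ 2 → i = p ∨ j = p := by
  classical
  obtain ⟨a, ha⟩ := Finite.exists_max l
  obtain ⟨b, hb⟩ := Finite.exists_min l
  have two (i j : ι) (hij : i ≠ j) : l i ^ 2 + l j ^ 2 ≤ ∑ k, l k ^ 2 := by
    rw [← Finset.sum_pair (f := fun k => l k ^ 2) hij]
    exact Finset.sum_le_sum_of_subset_of_nonneg (Finset.subset_univ _) fun _ _ _ => sq_nonneg _
  have ordered (p : ι) (h : ¬ ∀ i j, ∑ k, l k ^ 2 < (l i - l j) ^ 2 → i = p ∨ j = p) :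
      ∃ i j, i ≠ p ∧ j ≠ p ∧ 0 < l i ∧ l j < 0 ∧ ∑ k, l k ^ 2 < (l i - l j) ^ 2 := by
    push Not at h
    obtain ⟨i, j, h, hi, hj⟩ := h
    have hij : i ≠ j := by
      rintro rfl
      have : 0 ≤ ∑ k, l k ^ 2 := Finset.sum_nonneg fun _ _ => sq_nonneg _
      simp only [sub_self] at h
      nlinarith
    have hneg : l i * l j < 0 := by nlinarith [two i j hij]
    rcases mul_neg_iff.mp hneg with ⟨h1, h2⟩ | ⟨h1, h2⟩
    · exact ⟨i, j, hi, hj, h1, h2, h⟩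
    · exact ⟨j, i, hj, hi, h2, h1, by nlinarith⟩
  by_contra! hcon
  obtain ⟨i, j, hia, -, hi, hj, hg⟩ := ordered a (by have := hcon a; push Not; exact this)
  obtain ⟨k, q, -, hqb, hk, hq, hg'⟩ := ordered b (by have := hcon b; push Not; exact this)
  have hbj := hb j
  have hak := ha k
  have four : l i ^ 2 + (l b ^ 2 + (l a ^ 2 + l q ^ 2)) ≤ ∑ k, l k ^ 2 := by
    have hib : i ≠ b := by rintro rfl; linarith
    have hiq : i ≠ q := by rintro rfl; linarith
    have hba : b ≠ a := by rintro rfl; linarith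
    have haq : a ≠ q := by rintro rfl; linarith
    have : ∑ k ∈ ({i, b, a, q} : Finset ι), l k ^ 2 = l i ^ 2 + (l b ^ 2 + (l a ^ 2 + l q ^ 2)) := by
      rw [Finset.sum_insert (by simp [hib, hiq, hia]), Finset.sum_insert (by simp [hba, hqb.symm]),
        Finset.sum_pair haq]
    rw [← this]
    exact Finset.sum_le_sum_of_subset_of_nonneg (Finset.subset_univ _) fun _ _ _ => sq_nonneg _
  have h1 : (l i - l j) ^ 2 ≤ (l i - l b) ^ 2 := by
    apply pow_le_pow_left₀ <;> linarith
  have h2 : (l k - l q) ^ 2 ≤ (l a - l q) ^ 2 := by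
    apply pow_le_pow_left₀ <;> linarith
  nlinarith [sq_nonneg (l i + l b), sq_nonneg (l a + l q)]

/-- The largest Laplacian eigenvalue of a star with leaf set `T` is `#T + 1`. -/
lemma sum_star_sq_sub_le (T : Finset ι) (p : ι) (hp : p ∉ T) (l : ι → ℝ) :
    ∑ j ∈ T, ((l p - l j) ^ 2 - ∑ k, l k ^ 2) ≤ ∑ k, l k ^ 2 := by
  classical
  have hle : l p ^ 2 + ∑ j ∈ T, l j ^ 2 ≤ ∑ k, l k ^ 2 := by
    rw [← Finset.sum_insert (f := fun k => l k ^ 2) hp]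
    exact Finset.sum_le_sum_of_subset_of_nonneg (Finset.subset_univ _) fun _ _ _ => sq_nonneg _
  have hcs : (∑ j ∈ T, l j) ^ 2 ≤ T.card * ∑ j ∈ T, l j ^ 2 := sq_sum_le_card_mul_sum_sq
  have hexp : ∑ j ∈ T, (l p - l j) ^ 2 =
      T.card * l p ^ 2 - 2 * l p * ∑ j ∈ T, l j + ∑ j ∈ T, l j ^ 2 := by
    simp only [sub_sq, Finset.sum_add_distrib, Finset.sum_sub_distrib, Finset.mul_sum,
      Finset.sum_const, nsmul_eq_mul]
  rw [Finset.sum_sub_distrib, hexp, Finset.sum_const, nsmul_eq_mul]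
  have hc : (0 : ℝ) ≤ T.card := by positivity
  nlinarith [sq_nonneg (l p + ∑ j ∈ T, l j), mul_le_mul_of_nonneg_left hle hc]

lemma sum_gap_posPart_le (l : ι → ℝ) :
    ∑ i, ∑ j, max ((l i - l j) ^ 2 - ∑ k, l k ^ 2) 0 ≤ 2 * ∑ k, l k ^ 2 := by
  classical
  rcases isEmpty_or_nonempty ι with h | h
  · simp
  obtain ⟨p, hp⟩ := exists_center_of_large_gaps l
  have hg : 0 ≤ ∑ k, l k ^ 2 := Finset.sum_nonneg fun _ _ => sq_nonneg _
  set g := ∑ k, l k ^ 2 with hgdef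
  set f : ι → ι → ℝ := fun i j => max ((l i - l j) ^ 2 - g) 0 with hf
  have hf0 (i j : ι) : 0 ≤ f i j := le_max_right _ _
  have hfs (i j : ι) : f i j = f j i := by
    simp only [hf]; congr 2; ring
  have hzero (i j : ι) (hi : i ≠ p) (hj : j ≠ p) : f i j = 0 := by
    refine max_eq_right ?_
    by_contra! h
    rcases hp i j (by linarith) with h | h <;> contradiction
  have hrow : ∑ j, f p j ≤ g := by
    have h := sum_star_sq_sub_le (Finset.univ.filter fun j => g < (l p - l j) ^ 2) p
      (by simpa using hg) l
    rw [Finset.sum_filter, ← hgdef] at h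
    refine le_trans (le_of_eq (Finset.sum_congr rfl fun j _ => ?_)) h
    simp only [hf]
    split_ifs with h'
    · exact max_eq_left (by linarith)
    · exact max_eq_right (by linarith)
  have hsplit : ∑ i, ∑ j, f i j ≤ ∑ j, f p j + ∑ i, f i p := by
    rw [← Finset.add_sum_erase _ _ (Finset.mem_univ p)]
    gcongr
    refine (Finset.sum_le_sum (g := fun i => f i p) fun i hi => le_of_eq ?_).trans
      (Finset.sum_le_sum_of_subset_of_nonneg (Finset.subset_univ _) fun i _ _ => hf0 i p)
    exact Finset.sum_eq_single p (fun j _ hj => hzero i j (Finset.ne_of_mem_erase hi) hj) (by simp)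
  have : ∑ i, f i p = ∑ j, f p j := Finset.sum_congr rfl fun i _ => hfs i p
  change ∑ i, ∑ j, f i j ≤ 2 * g
  linarith

end SpectralGaps

section Frobenius

variable {ι κ : Type*} [Fintype ι] [Fintype κ]

/-- The Frobenius inner product on real square matrices. -/
noncomputable def frob : LinearMap.BilinForm ℝ (Matrix ι ι ℝ) :=
  LinearMap.mk₂ ℝ (fun X Y => ∑ i, ∑ j, X i j * Y i j)
    (fun X X' Y => by simp [add_mul, Finset.sum_add_distrib])
    (fun c X Y => by simp [Finset.mul_sum, mul_assoc])
    (fun X Y Y' => by simp [mul_add, Finset.sum_add_distrib])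
    (fun c X Y => by simp [Finset.mul_sum, mul_left_comm])

lemma frob_apply (X Y : Matrix ι ι ℝ) : frob X Y = ∑ i, ∑ j, X i j * Y i j := rfl

lemma frob_self (X : Matrix ι ι ℝ) : frob X X = ∑ i, ∑ j, X i j ^ 2 := by
  simp [frob_apply, sq]

lemma frob_comm (X Y : Matrix ι ι ℝ) : frob X Y = frob Y X := by
  simp [frob_apply, mul_comm]

lemma frob_self_nonneg (X : Matrix ι ι ℝ) : 0 ≤ frob X X := by
  rw [frob_self]; positivity

lemma frob_sq_le (X Y : Matrix ι ι ℝ) : frob X Y ^ 2 ≤ frob X X * frob Y Y := by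
  simp only [frob_self, frob_apply, ← Fintype.sum_prod_type']
  exact Finset.sum_mul_sq_le_sq_mul_sq _ _ _

lemma frob_eq_trace (X Y : Matrix ι ι ℝ) : frob X Y = (X * Yᵀ).trace := by
  simp [frob_apply, trace, mul_apply]

variable [DecidableEq ι]

lemma frob_conj (U X Y : Matrix ι ι ℝ) (hU : Uᵀ * U = 1) :
    frob (U * X * Uᵀ) (U * Y * Uᵀ) = frob X Y := by
  simp only [frob_eq_trace, transpose_mul, transpose_transpose]
  calc (U * X * Uᵀ * (U * (Yᵀ * Uᵀ))).trace
      = (U * (X * (Uᵀ * U) * Yᵀ) * Uᵀ).trace := by simp only [Matrix.mul_assoc]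
    _ = (X * Yᵀ).trace := by
      rw [trace_mul_comm, ← Matrix.mul_assoc, hU, Matrix.one_mul, Matrix.mul_one]

lemma sum_frob_lie_diagonal_le (l : ι → ℝ) (C : κ → Matrix ι ι ℝ)
    (hC : ∀ i j, i ≠ j → 2 * ∑ b, C b i j ^ 2 ≤ ∑ k, l k ^ 2) :
    ∑ b, frob ⁅diagonal l, C b⁆ ⁅diagonal l, C b⁆ ≤
      (∑ k, l k ^ 2) * (∑ b, frob (C b) (C b) + ∑ k, l k ^ 2) := by
  have hgap := sum_gap_posPart_le l
  have hg : 0 ≤ ∑ k, l k ^ 2 := Finset.sum_nonneg fun _ _ => sq_nonneg _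
  set g := ∑ k, l k ^ 2
  have swap (f : κ → ι → ι → ℝ) : ∑ b, ∑ i, ∑ j, f b i j = ∑ i, ∑ j, ∑ b, f b i j := by
    rw [Finset.sum_comm]
    exact Finset.sum_congr rfl fun i _ => Finset.sum_comm
  have h1 : ∑ b, frob ⁅diagonal l, C b⁆ ⁅diagonal l, C b⁆ =
      ∑ i, ∑ j, (l i - l j) ^ 2 * ∑ b, C b i j ^ 2 := by
    simp only [frob_self, swap, Finset.mul_sum]
    refine Finset.sum_congr rfl fun i _ => Finset.sum_congr rfl fun j _ =>
      Finset.sum_congr rfl fun b _ => ?_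
    simp [Ring.lie_def]
    ring
  have h2 : g * ∑ b, frob (C b) (C b) = ∑ i, ∑ j, g * ∑ b, C b i j ^ 2 := by
    simp only [frob_self, swap, Finset.mul_sum]
  have h3 : ∑ i, ∑ j, (l i - l j) ^ 2 * ∑ b, C b i j ^ 2 ≤
      ∑ i, ∑ j, (g * ∑ b, C b i j ^ 2 + g / 2 * max ((l i - l j) ^ 2 - g) 0) := by
    refine Finset.sum_le_sum fun i _ => Finset.sum_le_sum fun j _ => ?_
    have hs : 0 ≤ ∑ b, C b i j ^ 2 := Finset.sum_nonneg fun _ _ => sq_nonneg _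
    rcases eq_or_ne i j with rfl | hij
    · have : 0 ≤ max ((l i - l i) ^ 2 - g) 0 := le_max_right _ _
      rw [show (l i - l i) ^ 2 * ∑ b, C b i i ^ 2 = 0 by simp]
      positivity
    · have hC := hC i j hij
      have hm := le_max_left ((l i - l j) ^ 2 - g) 0
      have hm0 := le_max_right ((l i - l j) ^ 2 - g) 0
      nlinarith [mul_le_mul_of_nonneg_right hm hs, mul_le_mul_of_nonneg_left hC hm0]
  simp only [Finset.sum_add_distrib, ← Finset.mul_sum] at h3 h2
  rw [h1, mul_add, h2]
  nlinarith [mul_le_mul_of_nonneg_left hgap hg]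

lemma sum_frob_lie_le (B : Matrix ι ι ℝ) (hB : B.IsSymm) (C : κ → Matrix ι ι ℝ)
    (hsymm : ∀ b, (C b).IsSymm)
    (hC : ∀ E, ∑ b, frob (C b) E ^ 2 ≤ frob B B * frob E E) :
    ∑ b, frob ⁅B, C b⁆ ⁅B, C b⁆ ≤ frob B B * (∑ b, frob (C b) (C b) + frob B B) := by
  have hH : B.IsHermitian := by rwa [IsHermitian, conjTranspose_eq_transpose_of_trivial]
  obtain ⟨U, l, hU, hU', hBU⟩ : ∃ (U : Matrix ι ι ℝ) (l : ι → ℝ),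
      Uᵀ * U = 1 ∧ U * Uᵀ = 1 ∧ B = U * diagonal l * Uᵀ := by
    refine ⟨hH.eigenvectorUnitary, hH.eigenvalues, ?_, ?_, ?_⟩
    · simpa [star_eq_conjTranspose] using Unitary.coe_star_mul_self hH.eigenvectorUnitary
    · simpa [star_eq_conjTranspose] using Unitary.coe_mul_star_self hH.eigenvectorUnitary
    · simpa [star_eq_conjTranspose, Unitary.conjStarAlgAut_apply, Function.comp_def]
        using hH.spectral_theorem
  obtain ⟨K, hK⟩ : ∃ K : κ → Matrix ι ι ℝ, ∀ b, K b = Uᵀ * C b * U := ⟨_, fun _ => rfl⟩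
  have hCU (b : κ) : C b = U * K b * Uᵀ := by
    calc C b = (U * Uᵀ) * C b * (U * Uᵀ) := by rw [hU']; simp
      _ = _ := by simp only [hK, Matrix.mul_assoc]
  have hKs (b : κ) : (K b).IsSymm := by
    simp only [hK, IsSymm, transpose_mul, transpose_transpose, (hsymm b).eq, Matrix.mul_assoc]
  have hlie (b : κ) : ⁅B, C b⁆ = U * ⁅diagonal l, K b⁆ * Uᵀ := by
    have key (X Y : Matrix ι ι ℝ) : (U * X * Uᵀ) * (U * Y * Uᵀ) = U * (X * Y) * Uᵀ := by
      calc _ = U * X * (Uᵀ * U) * Y * Uᵀ := by simp only [Matrix.mul_assoc]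
        _ = _ := by rw [hU]; simp only [Matrix.mul_one, Matrix.mul_assoc]
    rw [hBU, hCU b, Ring.lie_def, Ring.lie_def, key, key, Matrix.mul_sub, Matrix.sub_mul]
  have hBB : frob B B = ∑ k, l k ^ 2 := by
    rw [hBU, frob_conj U _ _ hU, frob_self]
    refine Finset.sum_congr rfl fun i _ => ?_
    rw [Finset.sum_eq_single i] <;> simp +contextual [eq_comm]
  have hCC (b : κ) : frob (C b) (C b) = frob (K b) (K b) := by
    conv_lhs => rw [hCU b]
    exact frob_conj U _ _ hU
  simp only [hlie, frob_conj U _ _ hU, hCC, hBB]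
  refine sum_frob_lie_diagonal_le l K fun i j hij => ?_
  have h := hC (U * (single i j 1 + single j i 1) * Uᵀ)
  have hb (b : κ) : frob (C b) (U * (single i j 1 + single j i 1) * Uᵀ) = 2 * K b i j := by
    conv_lhs => rw [hCU b]
    rw [frob_conj U _ _ hU, frob_eq_trace]
    simp only [transpose_add, transpose_single, Matrix.mul_add, trace_add, trace_mul_single]
    simp only [(hKs b).apply i j, MulOpposite.op_one, one_smul]
    ring
  have hE : frob (U * (single i j 1 + single j i 1) * Uᵀ)
      (U * (single i j 1 + single j i 1) * Uᵀ) = 2 := by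
    rw [frob_conj U _ _ hU, frob_eq_trace]
    simp only [transpose_add, transpose_single, Matrix.mul_add, trace_add, trace_mul_single]
    simp [hij, hij.symm]
    norm_num
  simp only [hb, hE, hBB, mul_pow, ← Finset.mul_sum] at h
  linarith

end Frobenius

section Extremal

/-- A continuous function, homogeneous of degree `2 * d`, attains its maximum on the unit sphere of
a nonzero subspace. -/
lemma exists_sphere_max {κ : Type*} [Fintype κ] (W : Submodule ℝ (κ → ℝ)) (F : (κ → ℝ) → ℝ)
    (d : ℕ) (hF : Continuous F) (hom : ∀ (t : ℝ) x, F (t • x) = t ^ (2 * d) * F x)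
    (hW : ∃ x ∈ W, x ≠ 0) :
    ∃ x₀ ∈ W, ∑ i, x₀ i ^ 2 = 1 ∧ ∀ x ∈ W, x ≠ 0 → F x ≤ F x₀ * (∑ i, x i ^ 2) ^ d := by
  have hpos (x : κ → ℝ) (hx : x ≠ 0) : 0 < ∑ i, x i ^ 2 := by
    obtain ⟨i, hi⟩ := Function.ne_iff.mp hx
    exact Finset.sum_pos' (fun _ _ => sq_nonneg _) ⟨i, Finset.mem_univ i, by
      simp only [Pi.zero_apply] at hi; positivity⟩
  have hnorm (x : κ → ℝ) (hx : x ≠ 0) :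
      ∑ i, ((√(∑ i, x i ^ 2))⁻¹ • x) i ^ 2 = 1 := by
    simp only [Pi.smul_apply, smul_eq_mul, mul_pow, ← Finset.mul_sum, inv_pow]
    rw [Real.sq_sqrt (hpos x hx).le]
    exact inv_mul_cancel₀ (hpos x hx).ne'
  have hcomp : IsCompact ({x : κ → ℝ | ∑ i, x i ^ 2 = 1} ∩ (W : Set (κ → ℝ))) := by
    refine (isCompact_Icc (a := fun _ => (-1 : ℝ)) (b := fun _ => 1)).of_isClosed_subset
      ((isClosed_eq (by fun_prop) continuous_const).inter W.closed_of_finiteDimensional) ?_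
    rintro x ⟨hx, -⟩
    have hi (i : κ) : |x i| ≤ 1 := by
      rw [← sq_le_one_iff_abs_le_one, ← hx]
      exact Finset.single_le_sum (f := fun i => x i ^ 2) (fun _ _ => sq_nonneg _)
        (Finset.mem_univ i)
    exact ⟨fun i => (abs_le.mp (hi i)).1, fun i => (abs_le.mp (hi i)).2⟩
  obtain ⟨y, hyW, hy⟩ := hW
  obtain ⟨x₀, ⟨h1, hx₀W⟩, hmax⟩ := hcomp.exists_isMaxOn
    ⟨_, hnorm y hy, W.smul_mem _ hyW⟩ hF.continuousOn
  refine ⟨x₀, hx₀W, h1, fun x hxW hx => ?_⟩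
  have h := hmax ⟨hnorm x hx, W.smul_mem _ hxW⟩
  simp only [Set.mem_ofPred_eq, hom, inv_pow, pow_mul, Real.sq_sqrt (hpos x hx).le] at h
  rwa [inv_mul_le_iff₀ (pow_pos (hpos x hx) d), mul_comm] at h

lemma linear_coeff_eq_zero_of_nonneg (c₁ c₂ c₃ c₄ : ℝ)
    (h : ∀ t : ℝ, 0 ≤ c₁ * t + c₂ * t ^ 2 + c₃ * t ^ 3 + c₄ * t ^ 4) : c₁ = 0 := by
  have hd : HasDerivAt (fun t : ℝ => c₁ * t + c₂ * t ^ 2 + c₃ * t ^ 3 + c₄ * t ^ 4) c₁ 0 := by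
    refine (((((hasDerivAt_id' (0 : ℝ)).const_mul c₁).add
      ((hasDerivAt_pow 2 (0 : ℝ)).const_mul c₂)).add
      ((hasDerivAt_pow 3 (0 : ℝ)).const_mul c₃)).add
      ((hasDerivAt_pow 4 (0 : ℝ)).const_mul c₄)).congr_deriv ?_
    norm_num
  refine IsLocalMin.hasDerivAt_eq_zero (Filter.Eventually.of_forall fun t => ?_) hd
  simpa using h t

variable {ι κ : Type*} [Fintype ι] [Fintype κ]

lemma exists_top_direction [Nonempty κ] (A : κ → Matrix ι ι ℝ) :
    ∃ v : κ → ℝ, ∑ a, v a ^ 2 = 1 ∧ ∀ E, ∑ a, frob (A a) E ^ 2 ≤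
      frob (∑ a, v a • A a) (∑ a, v a • A a) * frob E E := by
  obtain ⟨v, -, hv, hmax⟩ := exists_sphere_max (⊤ : Submodule ℝ (κ → ℝ))
    (fun v => frob (∑ a, v a • A a) (∑ a, v a • A a)) 1
    (by simp only [map_sum, map_smul, LinearMap.sum_apply, LinearMap.smul_apply, smul_eq_mul]
        fun_prop)
    (fun t x => by
      simp only [Pi.smul_apply, smul_eq_mul, mul_smul, ← Finset.smul_sum, map_smul, LinearMap.smul_apply]
      ring)
    ⟨fun _ => 1, trivial, fun h => by simpa using congrFun h (Classical.arbitrary κ)⟩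
  refine ⟨v, hv, fun E => ?_⟩
  set g := frob (∑ a, v a • A a) (∑ a, v a • A a)
  have hg : 0 ≤ g := frob_self_nonneg _
  have hE := frob_self_nonneg E
  by_cases hw : (fun a => frob (A a) E) = 0
  · have (a : κ) : frob (A a) E = 0 := congrFun hw a
    simp only [this]
    simpa using mul_nonneg hg hE
  · have h := hmax _ trivial hw
    have hcs := frob_sq_le (∑ a, frob (A a) E • A a) E
    have hS : frob (∑ a, frob (A a) E • A a) E = ∑ a, frob (A a) E ^ 2 := by
      simp [LinearMap.sum_apply, sq]
    rw [hS] at hcs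
    simp only [pow_one] at h
    have hS0 : 0 ≤ ∑ a, frob (A a) E ^ 2 := Finset.sum_nonneg fun _ _ => sq_nonneg _
    rcases hS0.eq_or_lt with h0 | h0
    · rw [← h0]; positivity
    · nlinarith [mul_le_mul_of_nonneg_right h hE]

variable [DecidableEq ι]

lemma sum_frob_lie_top_direction_le (A : κ → Matrix ι ι ℝ) (hA : ∀ a, (A a).IsSymm)
    (v : κ → ℝ) (hv : ∑ a, v a ^ 2 = 1) (B : Matrix ι ι ℝ) (hB : B = ∑ a, v a • A a)
    (hmax : ∀ E, ∑ a, frob (A a) E ^ 2 ≤ frob B B * frob E E) :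
    ∑ a, frob ⁅B, A a⁆ ⁅B, A a⁆ ≤ frob B B * ∑ a, frob (A a) (A a) := by
  have hBs : B.IsSymm := by
    rw [hB, IsSymm, transpose_sum]
    exact Finset.sum_congr rfl fun a _ => by rw [transpose_smul, (hA a).eq]
  have hBE (E : Matrix ι ι ℝ) : ∑ a, v a * frob (A a) E = frob B E := by
    simp [hB, LinearMap.sum_apply]
  have h := sum_frob_lie_le B hBs (fun a => A a - v a • B)
    (fun a => (hA a).sub (hBs.smul (v a))) (fun E => ?_)
  · have h1 (a : κ) : ⁅B, A a - v a • B⁆ = ⁅B, A a⁆ := by simp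
    have h2 : ∑ a, frob (A a - v a • B) (A a - v a • B) =
        ∑ a, frob (A a) (A a) - frob B B := by
      have (a : κ) : frob (A a - v a • B) (A a - v a • B) =
          frob (A a) (A a) - 2 * (v a * frob (A a) B) + v a ^ 2 * frob B B := by
        simp only [map_sub, map_smul, LinearMap.sub_apply, LinearMap.smul_apply, smul_eq_mul,
          frob_comm B (A a)]
        ring
      simp only [this, Finset.sum_add_distrib, Finset.sum_sub_distrib, ← Finset.mul_sum,
        ← Finset.sum_mul, hBE, hv]
      ring
    simpa only [h1, h2, sub_add_cancel] using h
  · have (a : κ) : frob (A a - v a • B) E ^ 2 =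
        frob (A a) E ^ 2 - 2 * (v a * frob (A a) E) * frob B E + v a ^ 2 * frob B E ^ 2 := by
      simp only [map_sub, map_smul, LinearMap.sub_apply, LinearMap.smul_apply, smul_eq_mul]
      ring
    simp only [this, Finset.sum_add_distrib, Finset.sum_sub_distrib, ← Finset.mul_sum,
      ← Finset.sum_mul, hBE, hv]
    nlinarith [hmax E, sq_nonneg (frob B E)]

/-- First-order condition at a maximizer of the commutator energy, in a rank-one direction. -/
lemma max_mul_frob_eq_sum_frob_lie (A : κ → Matrix ι ι ℝ) (hA : ∀ a, (A a).IsSymm) (M : ℝ)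
    (hle : ∀ X : κ → Matrix ι ι ℝ, (∀ a, (X a).IsSymm) →
      ∑ a, ∑ b, frob ⁅X a, X b⁆ ⁅X a, X b⁆ ≤ M * (∑ a, frob (X a) (X a)) ^ 2)
    (hN : ∑ a, frob (A a) (A a) = 1) (hM : ∑ a, ∑ b, frob ⁅A a, A b⁆ ⁅A a, A b⁆ = M)
    (v : κ → ℝ) (hv : ∑ a, v a ^ 2 = 1) (B : Matrix ι ι ℝ) (hB : B = ∑ a, v a • A a) :
    M * frob B B = ∑ a, frob ⁅B, A a⁆ ⁅B, A a⁆ := by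
  have hBs : B.IsSymm := by
    rw [hB, IsSymm, transpose_sum]
    exact Finset.sum_congr rfl fun a _ => by rw [transpose_smul, (hA a).eq]
  have hBE (E : Matrix ι ι ℝ) : ∑ a, v a * frob (A a) E = frob B E := by
    simp [hB, LinearMap.sum_apply]
  have hBlie (a : κ) : ∑ b, v b * frob ⁅A b, A a⁆ ⁅B, A a⁆ = frob ⁅B, A a⁆ ⁅B, A a⁆ := by
    have : ⁅B, A a⁆ = ∑ b, v b • ⁅A b, A a⁆ := by
      rw [hB]
      simp only [Ring.lie_def, Finset.sum_mul, Finset.mul_sum, smul_mul_assoc, mul_smul_comm,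
        smul_sub, Finset.sum_sub_distrib]
    rw [congrArg frob this]
    simp [LinearMap.sum_apply]
  set Q := ∑ a, frob ⁅B, A a⁆ ⁅B, A a⁆ with hQ
  set g := frob B B
  set Y : κ → κ → Matrix ι ι ℝ := fun a b => v a • ⁅B, A b⁆ - v b • ⁅B, A a⁆ with hY
  set R := ∑ a, ∑ b, frob (Y a b) (Y a b)
  have hNt (t : ℝ) : ∑ a, frob (A a + (t * v a) • B) (A a + (t * v a) • B) =
      1 + 2 * t * g + t ^ 2 * g := by
    have (a : κ) : frob (A a + (t * v a) • B) (A a + (t * v a) • B) =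
        frob (A a) (A a) + 2 * t * (v a * frob (A a) B) + t ^ 2 * (v a ^ 2 * g) := by
      simp only [map_add, map_smul, LinearMap.add_apply, LinearMap.smul_apply, smul_eq_mul,
        frob_comm B (A a)]
      ring
    simp only [this, Finset.sum_add_distrib, ← Finset.mul_sum, ← Finset.sum_mul, hBE, hv, hN]
    ring
  have hcross : ∑ a, ∑ b, frob ⁅A a, A b⁆ (Y a b) = 2 * Q := by
    have h1 : ∑ a, ∑ b, v a * frob ⁅A a, A b⁆ ⁅B, A b⁆ = Q := by
      rw [Finset.sum_comm]
      exact Finset.sum_congr rfl fun a _ => hBlie a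
    have h2 : ∑ a, ∑ b, v b * frob ⁅A a, A b⁆ ⁅B, A a⁆ = -Q := by
      rw [hQ, ← Finset.sum_neg_distrib]
      refine Finset.sum_congr rfl fun a _ => ?_
      rw [← hBlie a, ← Finset.sum_neg_distrib]
      refine Finset.sum_congr rfl fun b _ => ?_
      rw [← lie_skew (A a) (A b)]
      simp only [map_neg, LinearMap.neg_apply]
      ring
    simp only [hY, map_sub, map_smul, smul_eq_mul, Finset.sum_sub_distrib, h1, h2]
    ring
  have hft (t : ℝ) : ∑ a, ∑ b, frob ⁅A a + (t * v a) • B, A b + (t * v b) • B⁆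
      ⁅A a + (t * v a) • B, A b + (t * v b) • B⁆ = M + 2 * t * (2 * Q) + t ^ 2 * R := by
    have (a b : κ) : ⁅A a + (t * v a) • B, A b + (t * v b) • B⁆ = ⁅A a, A b⁆ + t • Y a b := by
      simp only [hY, Ring.lie_def, add_mul, mul_add, smul_mul_assoc, mul_smul_comm]
      module
    have h' (a b : κ) : frob (⁅A a, A b⁆ + t • Y a b) (⁅A a, A b⁆ + t • Y a b) =
        frob ⁅A a, A b⁆ ⁅A a, A b⁆ + 2 * t * frob ⁅A a, A b⁆ (Y a b) +
          t ^ 2 * frob (Y a b) (Y a b) := by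
      simp only [map_add, map_smul, LinearMap.add_apply, LinearMap.smul_apply, smul_eq_mul,
        frob_comm (Y a b) ⁅A a, A b⁆]
      ring
    simp only [this, h', Finset.sum_add_distrib, ← Finset.mul_sum, hcross, hM]
    rfl
  have hlin := linear_coeff_eq_zero_of_nonneg (4 * (M * g - Q)) (M * (4 * g ^ 2 + 2 * g) - R)
    (4 * M * g ^ 2) (M * g ^ 2) fun t => by
      have h := hle (fun a => A a + (t * v a) • B) fun a => (hA a).add (hBs.smul _)
      rw [hNt, hft] at h
      nlinarith
  linarith

theorem sum_frob_lie_le_sq (A : κ → Matrix ι ι ℝ) (hA : ∀ a, (A a).IsSymm) :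
    ∑ a, ∑ b, frob ⁅A a, A b⁆ ⁅A a, A b⁆ ≤ (∑ a, frob (A a) (A a)) ^ 2 := by
  by_cases hA0 : A = 0
  · simp [hA0]
  have : Nonempty κ := by
    by_contra h
    rw [not_nonempty_iff] at h
    exact hA0 (Subsingleton.elim _ _)
  let T : (κ × ι × ι → ℝ) → κ → Matrix ι ι ℝ := fun x a => of fun i j => x (a, i, j)
  let S : (κ → Matrix ι ι ℝ) → κ × ι × ι → ℝ := fun X p => X p.1 p.2.1 p.2.2
  let W : Submodule ℝ (κ × ι × ι → ℝ) :=
    { carrier := {x | ∀ a i j, x (a, i, j) = x (a, j, i)}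
      add_mem' := fun hx hy a i j => by simp [hx a i j, hy a i j]
      zero_mem' := fun _ _ _ => rfl
      smul_mem' := fun c x hx a i j => by simp [hx a i j] }
  have hSW (X : κ → Matrix ι ι ℝ) (hX : ∀ a, (X a).IsSymm) : S X ∈ W :=
    fun a i j => (hX a).apply j i
  have hS0 (X : κ → Matrix ι ι ℝ) (hX : X ≠ 0) : S X ≠ 0 := fun h => hX <| by
    ext a i j
    exact congrFun h (a, i, j)
  have hnorm (x : κ × ι × ι → ℝ) : ∑ p, x p ^ 2 = ∑ a, frob (T x a) (T x a) := by
    simp [frob_self, Fintype.sum_prod_type, T]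
  obtain ⟨x, hxW, hx1, hmax⟩ := exists_sphere_max W
    (fun x => ∑ a, ∑ b, frob ⁅T x a, T x b⁆ ⁅T x a, T x b⁆) 2
    (by
      simp only [frob_apply, Ring.lie_def, Matrix.sub_apply, mul_apply, T, of_apply]
      fun_prop)
    (fun t x => by
      have hT (a : κ) : T (t • x) a = t • T x a := rfl
      simp only [hT, smul_lie, lie_smul, map_smul, LinearMap.smul_apply, smul_eq_mul,
        ← Finset.mul_sum]
      ring)
    ⟨S A, hSW A hA, hS0 A hA0⟩
  set M := ∑ a, ∑ b, frob ⁅T x a, T x b⁆ ⁅T x a, T x b⁆ with hM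
  have hle (X : κ → Matrix ι ι ℝ) (hX : ∀ a, (X a).IsSymm) :
      ∑ a, ∑ b, frob ⁅X a, X b⁆ ⁅X a, X b⁆ ≤ M * (∑ a, frob (X a) (X a)) ^ 2 := by
    by_cases hX0 : X = 0
    · simp [hX0]
    have h := hmax (S X) (hSW X hX) (hS0 X hX0)
    rw [hnorm] at h
    exact h
  have hxs (a : κ) : (T x a).IsSymm := by
    ext i j
    exact hxW a j i
  rw [hnorm] at hx1
  obtain ⟨v, hv, htop⟩ := exists_top_direction (T x)
  have hfirst := max_mul_frob_eq_sum_frob_lie (T x) hxs M hle hx1 hM.symm v hv _ rfl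
  have hbound := sum_frob_lie_top_direction_le (T x) hxs v hv _ rfl htop
  rw [← hfirst, hx1, mul_one] at hbound
  set g := frob (∑ a, v a • T x a) (∑ a, v a • T x a)
  have hg : 0 < g := by
    refine (frob_self_nonneg _).lt_of_ne fun h0 => ?_
    have hz (a : κ) : frob (T x a) (T x a) = 0 := by
      have h := htop (T x a)
      rw [show g = 0 from h0.symm, zero_mul] at h
      have := (Finset.single_le_sum (f := fun b => frob (T x b) (T x a) ^ 2)
        (fun _ _ => sq_nonneg _) (Finset.mem_univ a)).trans h
      exact pow_eq_zero_iff two_ne_zero |>.mp (le_antisymm this (sq_nonneg _))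
    simp [hz] at hx1
  have hM1 : M ≤ 1 := by
    by_contra! h
    nlinarith
  exact (hle A hA).trans (mul_le_of_le_one_left (sq_nonneg _) hM1)

end Extremal

theorem stmt_8 (n m : ℕ) (hn : 2 ≤ n) (hm : 2 ≤ m)
    (A : Fin m → Matrix (Fin n) (Fin n) ℝ)
    (hsymm : ∀ r, (A r).IsSymm) :
    (∑ r, ∑ i, ∑ j, (A r i j) ^ 2) ^ 2 ≥
      2 * ∑ p ∈ Finset.univ.filter (fun p : Fin m × Fin m => p.1 < p.2),
        ∑ i, ∑ j, ((A p.1 * A p.2 - A p.2 * A p.1) i j) ^ 2 := by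
  have h := sum_frob_lie_le_sq A hsymm
  let f : Fin m × Fin m → ℝ := fun p => frob ⁅A p.1, A p.2⁆ ⁅A p.1, A p.2⁆
  have hswap : ∑ p with p.1 < p.2, f p = ∑ p with p.2 < p.1, f p := by
    refine Finset.sum_equiv (Equiv.prodComm _ _) (by simp) fun p _ => ?_
    simp only [f, Equiv.prodComm_apply, Prod.fst_swap, Prod.snd_swap]
    rw [← lie_skew (A p.1) (A p.2)]
    simp only [map_neg, LinearMap.neg_apply, neg_neg]
  have hsplit : ∑ a, ∑ b, frob ⁅A a, A b⁆ ⁅A a, A b⁆ =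
      ∑ p with p.1 < p.2, f p + ∑ p with p.2 < p.1, f p := by
    rw [← Fintype.sum_prod_type', Finset.sum_filter, Finset.sum_filter, ← Finset.sum_add_distrib]
    refine Finset.sum_congr rfl fun p _ => ?_
    rcases lt_trichotomy p.1 p.2 with h | h | h
    · simp [h, h.not_gt, f]
    · simp [h]
    · simp [h, h.not_gt, f]
  rw [hsplit, ← hswap, ← two_mul] at h
  simpa only [f, frob_self, Ring.lie_def] using h
end

section
/- For any two n×n real matrices X and Y, ‖[X,Y]‖² ≤ 2‖X‖²‖Y‖², where ‖·‖ is the Frobenius norm and [X,Y] = XY − YX (the Böttcher–Wenzel inequality). -/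
open Matrix

/-- The squared Frobenius norm of a real matrix. -/
def Matrix.frobSq {ι κ : Type*} [Fintype ι] [Fintype κ] (M : Matrix ι κ ℝ) : ℝ :=
  ∑ i, ∑ j, (M i j) ^ 2

namespace Matrix

variable {ι κ : Type*} [Fintype ι] [Fintype κ]

lemma frobSq_nonneg (M : Matrix ι κ ℝ) : 0 ≤ frobSq M :=
  Finset.sum_nonneg fun _ _ => Finset.sum_nonneg fun _ _ => sq_nonneg _

lemma frobSq_transpose (M : Matrix ι κ ℝ) : frobSq Mᵀ = frobSq M :=
  Finset.sum_comm

lemma frobSq_eq_trace (M : Matrix ι κ ℝ) : frobSq M = (Mᵀ * M).trace := by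
  simp only [frobSq, trace, diag_apply, mul_apply, transpose_apply, ← sq]
  exact Finset.sum_comm

lemma frobSq_add_add_frobSq_sub (M N : Matrix ι κ ℝ) :
    frobSq (M + N) + frobSq (M - N) = 2 * (frobSq M + frobSq N) := by
  simp only [frobSq, ← Finset.sum_add_distrib, Finset.mul_sum, add_apply, sub_apply]
  refine Finset.sum_congr rfl fun i _ => Finset.sum_congr rfl fun j _ => ?_
  ring

lemma frobSq_commutator_le (X Y : Matrix ι ι ℝ) :
    frobSq (X * Y - Y * X) ≤
      frobSq (X * Y) + frobSq (Xᵀ * Y) + (frobSq (Y * X) + frobSq (Y * Xᵀ)) := by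
  have h := frobSq_nonneg (Xᵀ * Y + Y * Xᵀ)
  suffices frobSq (X * Y - Y * X) + frobSq (Xᵀ * Y + Y * Xᵀ) =
      frobSq (X * Y) + frobSq (Xᵀ * Y) + (frobSq (Y * X) + frobSq (Y * Xᵀ)) by linarith
  have h₁ : (Yᵀ * (Xᵀ * (Y * X))).trace = (Yᵀ * (X * (Y * Xᵀ))).trace := by
    rw [← trace_transpose]
    simp only [transpose_mul, transpose_transpose, Matrix.mul_assoc]
    rw [trace_mul_comm]
    simp only [Matrix.mul_assoc]
  have h₂ : (Xᵀ * (Yᵀ * (X * Y))).trace = (Yᵀ * (X * (Y * Xᵀ))).trace := by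
    rw [trace_mul_comm]
    simp only [Matrix.mul_assoc]
  have h₃ : (X * (Yᵀ * (Xᵀ * Y))).trace = (Yᵀ * (Xᵀ * (Y * X))).trace := by
    rw [trace_mul_comm]
    simp only [Matrix.mul_assoc]
  simp only [frobSq_eq_trace, transpose_sub, transpose_add, transpose_mul, transpose_transpose,
    Matrix.sub_mul, Matrix.mul_sub, Matrix.add_mul, Matrix.mul_add, trace_sub, trace_add,
    Matrix.mul_assoc]
  linarith

lemma frobSq_mul_eq_of_transpose_mul_self [DecidableEq ι] {U : Matrix ι ι ℝ} (hU : Uᵀ * U = 1)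
    (M : Matrix ι κ ℝ) : frobSq (U * M) = frobSq M := by
  rw [frobSq_eq_trace, frobSq_eq_trace, transpose_mul, Matrix.mul_assoc, ← Matrix.mul_assoc Uᵀ, hU,
    Matrix.one_mul]

lemma frobSq_diagonal [DecidableEq ι] (a : ι → ℝ) : frobSq (diagonal a) = ∑ i, a i ^ 2 := by
  simp [frobSq, diagonal_apply, ite_pow]

lemma frobSq_diagonal_mul_le [DecidableEq ι] {a : ι → ℝ} {r : ℝ} (h : ∀ i, a i ^ 2 ≤ r)
    (M : Matrix ι κ ℝ) : frobSq (diagonal a * M) ≤ r * frobSq M := by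
  simp only [frobSq, Finset.mul_sum, diagonal_mul, mul_pow]
  gcongr with i _ j _
  exact h i

lemma exists_forall_sub_sq_le (a : ι → ℝ) : ∃ c, ∀ i, (a i - c) ^ 2 ≤ (∑ j, a j ^ 2) / 2 := by
  classical
  rcases isEmpty_or_nonempty ι with h | h
  · exact ⟨0, fun i => h.elim i⟩
  obtain ⟨p, hp⟩ := Finite.exists_max a
  obtain ⟨q, hq⟩ := Finite.exists_min a
  have hs : 0 ≤ ∑ j, a j ^ 2 := Finset.sum_nonneg fun _ _ => sq_nonneg _
  refine ⟨(a p + a q) / 2, fun i => ?_⟩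
  have hip := hp i
  have hiq := hq i
  rcases eq_or_ne p q with rfl | hpq
  · have : a i = a p := le_antisymm hip hiq
    rw [this]
    ring_nf
    linarith
  · have hle : ∑ j ∈ {p, q}, a j ^ 2 ≤ ∑ j, a j ^ 2 :=
      Finset.sum_le_sum_of_subset_of_nonneg (Finset.subset_univ _) fun _ _ _ => sq_nonneg _
    rw [Finset.sum_pair hpq] at hle
    nlinarith [mul_nonneg (sub_nonneg.2 hip) (sub_nonneg.2 hiq), sq_nonneg (a p + a q)]

lemma exists_frobSq_sub_scalar_mul_le [DecidableEq ι] {A : Matrix ι ι ℝ} (hA : Aᵀ = A) :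
    ∃ c : ℝ, ∀ M : Matrix ι ι ℝ, frobSq ((A - c • 1) * M) ≤ frobSq A / 2 * frobSq M := by
  have hH : A.IsHermitian := by rw [IsHermitian, conjTranspose_eq_transpose_of_trivial, hA]
  obtain ⟨U, a, hU, hU', rfl⟩ : ∃ (U : Matrix ι ι ℝ) (a : ι → ℝ),
      Uᵀ * U = 1 ∧ U * Uᵀ = 1 ∧ A = U * diagonal a * Uᵀ := by
    refine ⟨hH.eigenvectorUnitary, hH.eigenvalues, ?_, ?_, ?_⟩
    · simpa [star_eq_conjTranspose] using Unitary.coe_star_mul_self hH.eigenvectorUnitary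
    · simpa [star_eq_conjTranspose] using Unitary.coe_mul_star_self hH.eigenvectorUnitary
    · simpa [star_eq_conjTranspose, Unitary.conjStarAlgAut_apply, Function.comp_def]
        using hH.spectral_theorem
  obtain ⟨c, hc⟩ := exists_forall_sub_sq_le a
  have hUt : Uᵀᵀ * Uᵀ = 1 := by rwa [transpose_transpose]
  have hnorm : frobSq (U * diagonal a * Uᵀ) = ∑ i, a i ^ 2 := by
    rw [Matrix.mul_assoc, frobSq_mul_eq_of_transpose_mul_self hU, ← frobSq_transpose,
      transpose_mul, transpose_transpose, frobSq_mul_eq_of_transpose_mul_self hU,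
      frobSq_transpose, frobSq_diagonal]
  refine ⟨c, fun M => ?_⟩
  have hsub : U * diagonal a * Uᵀ - c • 1 = U * diagonal (fun i => a i - c) * Uᵀ := by
    have : diagonal (fun i => a i - c) = diagonal a - c • (1 : Matrix ι ι ℝ) := by
      rw [smul_one_eq_diagonal, diagonal_sub]
    rw [this, Matrix.mul_sub, Matrix.sub_mul, Matrix.mul_smul, Matrix.mul_one, Matrix.smul_mul,
      hU']
  rw [hsub, hnorm, Matrix.mul_assoc, Matrix.mul_assoc, frobSq_mul_eq_of_transpose_mul_self hU,
    ← frobSq_mul_eq_of_transpose_mul_self hUt M]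
  exact frobSq_diagonal_mul_le hc _

lemma dotProduct_mulVec_self_le_of_transpose_eq_neg {B : Matrix ι ι ℝ} (hB : Bᵀ = -B)
    (v : ι → ℝ) : (B *ᵥ v) ⬝ᵥ (B *ᵥ v) ≤ frobSq B / 2 * (v ⬝ᵥ v) := by
  set w := B *ᵥ v with hw
  have hwv : w ⬝ᵥ v = 0 := by
    have : w ⬝ᵥ v = -(w ⬝ᵥ v) := by
      conv_lhs => rw [dotProduct_comm, hw, dotProduct_mulVec, ← mulVec_transpose, hB, neg_mulVec,
        neg_dotProduct]
    linarith
  have hBvw : v ⬝ᵥ (B *ᵥ w) = -(w ⬝ᵥ w) := by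
    rw [dotProduct_mulVec, ← mulVec_transpose, hB, neg_mulVec, neg_dotProduct]
  have hK : ∑ i, ∑ j, B i j * (w i * v j - v i * w j) = 2 * (w ⬝ᵥ w) := by
    have h₁ : ∑ i, ∑ j, B i j * (w i * v j - v i * w j) = w ⬝ᵥ (B *ᵥ v) - v ⬝ᵥ (B *ᵥ w) := by
      simp only [dotProduct, mulVec, Finset.mul_sum, ← Finset.sum_sub_distrib]
      refine Finset.sum_congr rfl fun i _ => Finset.sum_congr rfl fun j _ => ?_
      ring
    rw [h₁, hBvw, ← hw]
    ring
  have hK' : ∑ i, ∑ j, (w i * v j - v i * w j) ^ 2 = 2 * ((w ⬝ᵥ w) * (v ⬝ᵥ v)) := by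
    have h₁ : ∑ i, ∑ j, (w i * v j - v i * w j) ^ 2 =
        (w ⬝ᵥ w) * (v ⬝ᵥ v) + (v ⬝ᵥ v) * (w ⬝ᵥ w) - 2 * ((w ⬝ᵥ v) * (w ⬝ᵥ v)) := by
      simp only [dotProduct, Finset.sum_mul_sum]
      simp only [Finset.mul_sum, ← Finset.sum_sub_distrib, ← Finset.sum_add_distrib]
      refine Finset.sum_congr rfl fun i _ => Finset.sum_congr rfl fun j _ => ?_
      ring
    rw [h₁, hwv]
    ring
  have hCS := Finset.sum_mul_sq_le_sq_mul_sq (Finset.univ : Finset (ι × ι))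
    (fun p => B p.1 p.2) (fun p => w p.1 * v p.2 - v p.1 * w p.2)
  simp only [Fintype.sum_prod_type] at hCS
  rw [hK, hK'] at hCS
  change _ ≤ frobSq B * _ at hCS
  have hv : 0 ≤ v ⬝ᵥ v := Finset.sum_nonneg fun _ _ => mul_self_nonneg _
  have hw₀ : 0 ≤ w ⬝ᵥ w := Finset.sum_nonneg fun _ _ => mul_self_nonneg _
  rcases hw₀.eq_or_lt with h | h
  · rw [← h]
    exact mul_nonneg (div_nonneg (frobSq_nonneg B) two_pos.le) hv
  · refine le_of_mul_le_mul_left ?_ h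
    linarith

lemma frobSq_eq_sum_dotProduct_col (M : Matrix ι κ ℝ) :
    frobSq M = ∑ j, (M.col j) ⬝ᵥ (M.col j) := by
  simp only [frobSq, dotProduct, col_apply, ← sq]
  exact Finset.sum_comm

lemma frobSq_mul_le_of_transpose_eq_neg {B : Matrix ι ι ℝ} (hB : Bᵀ = -B) (M : Matrix ι κ ℝ) :
    frobSq (B * M) ≤ frobSq B / 2 * frobSq M := by
  rw [frobSq_eq_sum_dotProduct_col (B * M), frobSq_eq_sum_dotProduct_col M, Finset.mul_sum]
  exact Finset.sum_le_sum fun j _ => dotProduct_mulVec_self_le_of_transpose_eq_neg hB (M.col j)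

lemma exists_frobSq_sub_scalar_mul_add_le [DecidableEq ι] (X : Matrix ι ι ℝ) :
    ∃ c : ℝ, ∀ M : Matrix ι ι ℝ,
      frobSq ((X - c • 1) * M) + frobSq ((X - c • 1)ᵀ * M) ≤ frobSq X * frobSq M := by
  obtain ⟨A, B, hA, hB, rfl⟩ : ∃ A B : Matrix ι ι ℝ, Aᵀ = A ∧ Bᵀ = -B ∧ X = A + B := by
    refine ⟨(1 / 2 : ℝ) • (X + Xᵀ), (1 / 2 : ℝ) • (X - Xᵀ), ?_, ?_, ?_⟩
    · simp [add_comm]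
    · simp [← smul_neg]
    · ext i j
      simp
      ring
  obtain ⟨c, hc⟩ := exists_frobSq_sub_scalar_mul_le hA
  refine ⟨c, fun M => ?_⟩
  have hX := frobSq_add_add_frobSq_sub A B
  have hT : frobSq (A - B) = frobSq (A + B) := by
    rw [← frobSq_transpose (A + B), transpose_add, hA, hB, sub_eq_add_neg]
  have h₁ : (A + B - c • 1) * M = (A - c • 1) * M + B * M := by
    rw [← Matrix.add_mul]
    congr 1
    abel
  have h₂ : (A + B - c • 1)ᵀ * M = (A - c • 1) * M - B * M := by
    rw [← Matrix.sub_mul, transpose_sub, transpose_add, transpose_smul, transpose_one, hA, hB]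
    congr 1
    abel
  rw [h₁, h₂, frobSq_add_add_frobSq_sub]
  have hXM : frobSq (A + B) = frobSq A + frobSq B := by linarith
  rw [hXM]
  linarith [hc M, frobSq_mul_le_of_transpose_eq_neg hB M]

/-- The **Böttcher–Wenzel inequality** for real matrices. -/
lemma frobSq_commutator_le_two_mul (X Y : Matrix ι ι ℝ) :
    frobSq (X * Y - Y * X) ≤ 2 * frobSq X * frobSq Y := by
  classical
  obtain ⟨c, hc⟩ := exists_frobSq_sub_scalar_mul_add_le X
  have hshift : X * Y - Y * X = (X - c • 1) * Y - Y * (X - c • 1) := by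
    simp [Matrix.sub_mul, Matrix.mul_sub]
  have h₁ := hc Y
  have h₂ := hc Yᵀ
  rw [← transpose_transpose (X - c • 1), ← transpose_mul, transpose_transpose, ← transpose_mul,
    frobSq_transpose, frobSq_transpose, frobSq_transpose] at h₂
  rw [hshift]
  linarith [frobSq_commutator_le (X - c • 1) Y]

end Matrix

theorem stmt_11 (n : ℕ) (X Y : Matrix (Fin n) (Fin n) ℝ) :
    ∑ i, ∑ j, ((X * Y - Y * X) i j) ^ 2 ≤
      2 * (∑ i, ∑ j, (X i j) ^ 2) * (∑ i, ∑ j, (Y i j) ^ 2) :=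
  Matrix.frobSq_commutator_le_two_mul X Y
end
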